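/- For each primitive fifth root of unity ζ, the twelve lines L₁,…,L₁₂ of 𝒜^ζ are pairwise distinct and realize the combinatorics 𝒜G: for every subset S ⊆ {1,…,12} with |S| ≥ 2, the lines {L_i : i ∈ S} have a common point in ℙ²(ℂ) if and only if S is contained in some member of 𝒫. -/

import Mathlib

open scoped LinearAlgebra.Projectivization
open Projectivization

abbrev P2 : Type := ℙ ℂ (Fin 3 → ℂ)

noncomputable instance : TopologicalSpace P2 :=
  inferInstanceAs (TopologicalSpace (Quotient (projectivizationSetoid ℂ (Fin 3 → ℂ))))

/-- The projective line `{[x:y:z] | v₀x + v₁y + v₂z = 0}` in `ℙ²(ℂ)`. -/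
def lineOf (v : Fin 3 → ℂ) : Set P2 :=
  {p | v 0 * p.rep 0 + v 1 * p.rep 1 + v 2 * p.rep 2 = 0}

/-- Coefficient vectors of the twelve lines of `𝒜^ζ`
(index `i : Fin 12` corresponds to the line `L_{i+1}`), with `ζ̄ = ζ⁻¹`. -/
noncomputable def coeffs (ζ : ℂ) : Fin 12 → Fin 3 → ℂ :=
  ![![1, 0, -1], ![1, 1, 0], ![1, 0, 1], ![1, -1, 0], ![0, 1, -1], ![0, 1, 1],
    ![1, -(ζ⁻¹ ^ 2 + ζ⁻¹), -(ζ ^ 2 + ζ)],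
    ![1, ζ⁻¹ + ζ ^ 2, -(ζ⁻¹ ^ 2 + ζ)],
    ![1, ζ ^ 2 + ζ, ζ⁻¹ ^ 2 + ζ⁻¹],
    ![1, -(ζ⁻¹ ^ 2 + ζ), ζ⁻¹ + ζ ^ 2],
    ![5, 1 + 2 * ζ + 3 * ζ ^ 2 - ζ⁻¹ ^ 2, -(2 + 4 * ζ + ζ ^ 2 + 3 * ζ⁻¹ ^ 2)],
    ![1, -(1 + ζ⁻¹), ζ⁻¹]]

/-- The line `L_{i+1}` of the arrangement `𝒜^ζ`. -/
noncomputable def lineA (ζ : ℂ) (i : Fin 12) : Set P2 := lineOf (coeffs ζ i)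

/-- The union of the twelve lines of the arrangement `𝒜^ζ`. -/
noncomputable def unionA (ζ : ℂ) : Set P2 := ⋃ i, lineA ζ i

/-- The point set `𝒫` of the combinatorics `𝒜G`, on the line set `Fin 12`
(index `i : Fin 12` corresponds to the line numbered `i+1` in the paper). -/
def calP : Finset (Finset (Fin 12)) :=
  { {0, 3, 4, 8, 11}, {0, 1, 5, 9}, {1, 2, 4, 6}, {2, 3, 5, 7}, {1, 7, 10, 11},
    {0, 6, 10}, {2, 8, 10}, {3, 9, 10}, {4, 7, 9}, {5, 6, 8},
    {4, 5}, {4, 10}, {5, 10}, {0, 2}, {1, 3}, {0, 7}, {1, 8}, {2, 9}, {3, 6},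
    {6, 7}, {6, 9}, {7, 8}, {8, 9}, {2, 11}, {5, 11}, {6, 11}, {9, 11} }

/-- Elements `a + b ζ + c ζ² + d ζ³` of `ℤ[ζ]`, `ζ` a primitive fifth root of unity, as
coordinate vectors. -/
structure CycInt where
  a : ℤ
  b : ℤ
  c : ℤ
  d : ℤ
deriving DecidableEq

namespace CycInt

instance : Zero CycInt := ⟨⟨0, 0, 0, 0⟩⟩

instance : Add CycInt := ⟨fun x y => ⟨x.a + y.a, x.b + y.b, x.c + y.c, x.d + y.d⟩⟩

instance : Sub CycInt := ⟨fun x y => ⟨x.a - y.a, x.b - y.b, x.c - y.c, x.d - y.d⟩⟩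

instance : Mul CycInt := ⟨fun x y =>
  let s := x.b * y.d + x.c * y.c + x.d * y.b
  ⟨x.a * y.a - s + (x.c * y.d + x.d * y.c), x.a * y.b + x.b * y.a - s + x.d * y.d,
    x.a * y.c + x.b * y.b + x.c * y.a - s,
    x.a * y.d + x.b * y.c + x.c * y.b + x.d * y.a - s⟩⟩

/-- The complex number with given coordinates in the basis `1, ζ, ζ², ζ³`. -/
def eval (ζ : ℂ) (x : CycInt) : ℂ := x.a + x.b * ζ + x.c * ζ ^ 2 + x.d * ζ ^ 3

lemma eval_add (ζ : ℂ) (x y : CycInt) : eval ζ (x + y) = eval ζ x + eval ζ y := by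
  change eval ζ ⟨_, _, _, _⟩ = _
  simp only [eval]
  push_cast
  ring

lemma eval_sub (ζ : ℂ) (x y : CycInt) : eval ζ (x - y) = eval ζ x - eval ζ y := by
  change eval ζ ⟨_, _, _, _⟩ = _
  simp only [eval]
  push_cast
  ring

lemma eval_mul {ζ : ℂ} (hζ : 1 + ζ + ζ ^ 2 + ζ ^ 3 + ζ ^ 4 = 0) (x y : CycInt) :
    eval ζ (x * y) = eval ζ x * eval ζ y := by
  change eval ζ ⟨_, _, _, _⟩ = _
  simp only [eval]
  push_cast
  linear_combination (-((x.b : ℂ) * y.d + x.c * y.c + x.d * y.b) -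
    (x.c * y.d + x.d * y.c) * (ζ - 1) - x.d * y.d * (ζ ^ 2 - ζ)) * hζ

lemma eval_eq_zero_iff {ζ : ℂ} (h : IsPrimitiveRoot ζ 5) (x : CycInt) :
    eval ζ x = 0 ↔ x = 0 := by
  refine ⟨fun hx => ?_, fun hx => ?_⟩
  · have hdeg : (minpoly ℤ ζ).natDegree = 4 := by
      rw [← Polynomial.cyclotomic_eq_minpoly h (by norm_num), Polynomial.natDegree_cyclotomic]
      decide
    let p : Polynomial ℤ := .C x.a + .C x.b * .X + .C x.c * .X ^ 2 + .C x.d * .X ^ 3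
    have hp : Polynomial.aeval ζ p = 0 := by simpa [p, eval] using hx
    have hp0 : p = 0 := by
      by_contra hne
      have hdvd := minpoly.isIntegrallyClosed_dvd (h.isIntegral (by norm_num)) hp
      have hle := Polynomial.natDegree_le_of_dvd hdvd hne
      have hlt : p.natDegree ≤ 3 := by
        simp only [p]
        compute_degree
      omega
    have hcoeff (n : ℕ) : p.coeff n = 0 := by simp [hp0]
    have h0 := hcoeff 0
    have h1 := hcoeff 1
    have h2 := hcoeff 2
    have h3 := hcoeff 3
    simp [p, -eq_intCast, Polynomial.coeff_X, Polynomial.coeff_X_pow, Polynomial.coeff_C]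
      at h0 h1 h2 h3
    obtain ⟨a, b, c, d⟩ := x
    simp only at h0 h1 h2 h3
    subst h0 h1 h2 h3
    rfl
  · subst hx
    change eval ζ ⟨0, 0, 0, 0⟩ = 0
    simp [eval]

end CycInt

/-- The cross product of two vectors, for scalars with bare arithmetic operations. -/
def crossVec {R : Type*} [Sub R] [Mul R] (u v : Fin 3 → R) : Fin 3 → R :=
  ![u 1 * v 2 - u 2 * v 1, u 2 * v 0 - u 0 * v 2, u 0 * v 1 - u 1 * v 0]

/-- The scalar product of two vectors, for scalars with bare arithmetic operations. -/
def dotVec {R : Type*} [Add R] [Mul R] (u v : Fin 3 → R) : R :=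
  u 0 * v 0 + u 1 * v 1 + u 2 * v 2

/-- The coordinates of `coeffs ζ` in the basis `1, ζ, ζ², ζ³`. -/
def intCoeffs : Fin 12 → Fin 3 → CycInt :=
  ![![⟨1, 0, 0, 0⟩, ⟨0, 0, 0, 0⟩, ⟨-1, 0, 0, 0⟩],
    ![⟨1, 0, 0, 0⟩, ⟨1, 0, 0, 0⟩, ⟨0, 0, 0, 0⟩],
    ![⟨1, 0, 0, 0⟩, ⟨0, 0, 0, 0⟩, ⟨1, 0, 0, 0⟩],
    ![⟨1, 0, 0, 0⟩, ⟨-1, 0, 0, 0⟩, ⟨0, 0, 0, 0⟩],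
    ![⟨0, 0, 0, 0⟩, ⟨1, 0, 0, 0⟩, ⟨-1, 0, 0, 0⟩],
    ![⟨0, 0, 0, 0⟩, ⟨1, 0, 0, 0⟩, ⟨1, 0, 0, 0⟩],
    ![⟨1, 0, 0, 0⟩, ⟨1, 1, 1, 0⟩, ⟨0, -1, -1, 0⟩],
    ![⟨1, 0, 0, 0⟩, ⟨-1, -1, 0, -1⟩, ⟨0, -1, 0, -1⟩],
    ![⟨1, 0, 0, 0⟩, ⟨0, 1, 1, 0⟩, ⟨-1, -1, -1, 0⟩],
    ![⟨1, 0, 0, 0⟩, ⟨0, -1, 0, -1⟩, ⟨-1, -1, 0, -1⟩],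
    ![⟨5, 0, 0, 0⟩, ⟨1, 2, 3, -1⟩, ⟨-2, -4, -1, -3⟩],
    ![⟨1, 0, 0, 0⟩, ⟨0, 1, 1, 1⟩, ⟨-1, -1, -1, -1⟩]]

/-- The exact determinant of the coefficients of three lines of the arrangement. -/
def intDet (i j k : Fin 12) : CycInt := dotVec (intCoeffs k) (crossVec (intCoeffs i) (intCoeffs j))

lemma exists_intDet_ne_zero : ∀ i j : Fin 12, i ≠ j → ∃ k, intDet i j k ≠ 0 := by
  decide +kernel

lemma exists_mem_calP_of_intDet_eq_zero :
    ∀ i j : Fin 12, i ≠ j → ∃ P ∈ calP, ∀ k, intDet i j k = 0 → k ∈ P := by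
  decide +kernel

lemma exists_intDet_eq_zero_of_mem_calP :
    ∀ P ∈ calP, ∃ i j : Fin 12, i ≠ j ∧ ∀ k ∈ P, intDet i j k = 0 := by
  have key : calP.filter (fun P => ¬ ∃ i j : Fin 12, i ≠ j ∧ ∀ k ∈ P, intDet i j k = 0) = ∅ := by
    decide +kernel
  simpa only [Finset.filter_eq_empty_iff, not_not] using key

lemma IsPrimitiveRoot.geom_sum_five {ζ : ℂ} (h : IsPrimitiveRoot ζ 5) :
    1 + ζ + ζ ^ 2 + ζ ^ 3 + ζ ^ 4 = 0 := by
  simpa [Finset.sum_range_succ] using h.geom_sum_eq_zero (by norm_num)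

lemma coeffs_eq_eval {ζ : ℂ} (h : IsPrimitiveRoot ζ 5) (i : Fin 12) (m : Fin 3) :
    coeffs ζ i m = (intCoeffs i m).eval ζ := by
  have hs := h.geom_sum_five
  have hinv : ζ⁻¹ = ζ ^ 4 := inv_eq_of_mul_eq_one_right (by
    linear_combination h.pow_eq_one)
  have hinv2 : (ζ ^ 4) ^ 2 = ζ ^ 3 := by linear_combination ζ ^ 3 * h.pow_eq_one
  unfold coeffs
  rw [hinv, hinv2]
  fin_cases i <;> fin_cases m <;> simp [intCoeffs, CycInt.eval] <;>
    first | ring1 | linear_combination hs | linear_combination -hs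

lemma dot_cross_coeffs_eq_zero_iff {ζ : ℂ} (h : IsPrimitiveRoot ζ 5) (i j k : Fin 12) :
    dotVec (coeffs ζ k) (crossVec (coeffs ζ i) (coeffs ζ j)) = 0 ↔ intDet i j k = 0 := by
  rw [← CycInt.eval_eq_zero_iff h]
  simp [intDet, dotVec, crossVec, CycInt.eval_add, CycInt.eval_sub, CycInt.eval_mul h.geom_sum_five,
    coeffs_eq_eval h]

lemma mk_mem_lineOf_iff (u v : Fin 3 → ℂ) (hv : v ≠ 0) :
    Projectivization.mk ℂ v hv ∈ lineOf u ↔ dotVec u v = 0 := by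
  obtain ⟨a, ha⟩ := Projectivization.exists_smul_eq_mk_rep ℂ v hv
  have hrep : dotVec u (Projectivization.mk ℂ v hv).rep = a * dotVec u v := by
    rw [← ha]
    simp only [dotVec, Pi.smul_apply, Units.smul_def, smul_eq_mul]
    ring
  change dotVec u (Projectivization.mk ℂ v hv).rep = 0 ↔ _
  simp [hrep]

lemma cross_ne_zero_of_dot_ne_zero {u v w : Fin 3 → ℂ} (hw : dotVec w (crossVec u v) ≠ 0) :
    crossVec u v ≠ 0 := fun h0 => hw (by simp [h0, dotVec])

lemma dot_cross_eq_zero_of_mem {u v w : Fin 3 → ℂ} {p : P2} (hu : p ∈ lineOf u)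
    (hv : p ∈ lineOf v) (hw : p ∈ lineOf w) : dotVec w (crossVec u v) = 0 := by
  by_contra hne
  refine p.rep_nonzero (funext fun m => (mul_eq_zero.mp ?_).resolve_left hne)
  simp only [lineOf, Set.mem_ofPred_eq] at hu hv hw
  simp only [dotVec, crossVec, Matrix.cons_val]
  fin_cases m <;> simp only [Fin.zero_eta, Fin.mk_one, Fin.reduceFinMk]
  · linear_combination (v 1 * w 2 - v 2 * w 1) * hu + (w 1 * u 2 - w 2 * u 1) * hv +
      (u 1 * v 2 - u 2 * v 1) * hw
  · linear_combination (v 2 * w 0 - v 0 * w 2) * hu + (w 2 * u 0 - w 0 * u 2) * hv +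
      (u 2 * v 0 - u 0 * v 2) * hw
  · linear_combination (v 0 * w 1 - v 1 * w 0) * hu + (w 0 * u 1 - w 1 * u 0) * hv +
      (u 0 * v 1 - u 1 * v 0) * hw

lemma cross_coeffs_ne_zero {ζ : ℂ} (h : IsPrimitiveRoot ζ 5) {i j : Fin 12} (hij : i ≠ j) :
    crossVec (coeffs ζ i) (coeffs ζ j) ≠ 0 := by
  obtain ⟨k, hk⟩ := exists_intDet_ne_zero i j hij
  exact cross_ne_zero_of_dot_ne_zero (mt (dot_cross_coeffs_eq_zero_iff h i j k).mp hk)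

lemma lineA_injective {ζ : ℂ} (h : IsPrimitiveRoot ζ 5) : Function.Injective (lineA ζ) := by
  intro i j hij
  by_contra hne
  obtain ⟨k, hk⟩ := exists_intDet_ne_zero i j hne
  have hdet := mt (dot_cross_coeffs_eq_zero_iff h i j k).mp hk
  have hperm : dotVec (coeffs ζ j) (crossVec (coeffs ζ i) (coeffs ζ k)) ≠ 0 := fun h0 => hdet (by
    simp only [dotVec, crossVec, Matrix.cons_val] at h0 ⊢
    linear_combination -h0)
  have hv := cross_ne_zero_of_dot_ne_zero hperm
  have hmem : Projectivization.mk ℂ _ hv ∈ lineA ζ i := (mk_mem_lineOf_iff _ _ hv).mpr (by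
    simp only [dotVec, crossVec, Matrix.cons_val]
    ring)
  rw [hij] at hmem
  exact hperm ((mk_mem_lineOf_iff _ _ hv).mp hmem)

/-- For each primitive fifth root of unity `ζ`, the twelve lines of `𝒜^ζ` are pairwise
distinct and realize the combinatorics `𝒜G`: a set of at least two of the lines has a
common point iff the corresponding index set is contained in a member of `𝒫`. -/
theorem statement6 (ζ : ℂ) (h : IsPrimitiveRoot ζ 5) :
    Function.Injective (lineA ζ) ∧
    ∀ S : Finset (Fin 12), 2 ≤ S.card →
      ((∃ p : P2, ∀ i ∈ S, p ∈ lineA ζ i) ↔ ∃ P ∈ calP, S ⊆ P) := by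
  refine ⟨lineA_injective h, fun S hS => ⟨?_, ?_⟩⟩
  · rintro ⟨p, hp⟩
    obtain ⟨i, hi, j, hj, hij⟩ := Finset.one_lt_card.mp hS
    obtain ⟨P, hP, hsub⟩ := exists_mem_calP_of_intDet_eq_zero i j hij
    exact ⟨P, hP, fun k hk => hsub k ((dot_cross_coeffs_eq_zero_iff h i j k).mp
      (dot_cross_eq_zero_of_mem (hp i hi) (hp j hj) (hp k hk)))⟩
  · rintro ⟨P, hP, hSP⟩
    obtain ⟨i, j, hij, hdet⟩ := exists_intDet_eq_zero_of_mem_calP P hP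
    exact ⟨Projectivization.mk ℂ _ (cross_coeffs_ne_zero h hij), fun k hk =>
      (mk_mem_lineOf_iff _ _ _).mpr ((dot_cross_coeffs_eq_zero_iff h i j k).mpr
        (hdet k (hSP hk)))⟩
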